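/- There exists δ ∈ (0, 1/4), depending only on p (independent of 𝒵 and of the solution), with the following property: suppose the initial data satisfy 2δ·ψ̂(0) ≥ |ψ̂(±1)| and δ·ψ̂(0) ≥ q²·|ψ̂(q)| for every q ∈ 𝒵 with |q| ≥ 2, and suppose t₁ ∈ (0, τ*) is such that for all t ∈ (0, t₁): 2δ·ψ̂(0) ≥ |k̂(±1,t)|, 2δ·ψ̂(0) ≥ q²·|k̂(q,t)| for every q ∈ 𝒵 with |q| ≥ 2, and k̂(0,t) ≥ (1−δ)·ψ̂(0). Then in fact δ·ψ̂(0) ≥ q²·|k̂(q,t)| for every q ∈ 𝒵 with |q| ≥ 2 and every t ∈ (0, t₁). -/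

import Mathlib

open Real MeasureTheory Filter Set

/-- `H(p,q₁,q₂) = 1/p - (p-1) q₁ q₂ - q₁²` (as a complex number). -/
noncomputable def Hcoef (p : ℕ) (q₁ q₂ : ℤ) : ℂ :=
  1 / (p : ℂ) - ((p : ℂ) - 1) * (q₁ : ℂ) * (q₂ : ℂ) - (q₁ : ℂ)^2

/-- The tuples `(q₁,…,q_{p+1})` (with `q_{p+2} := n - q₁ - ⋯ - q_{p+1}` determined) such that
the full `(p+2)`-tuple lies in `𝓐_n ∩ 𝒵^{p+2}`, i.e. all entries belong to `𝒵` and at least two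
entries of the full tuple are nonzero. -/
def fullTuple (p : ℕ) (n : ℤ) (v : Fin (p + 1) → ℤ) : Fin (p + 1 + 1) → ℤ :=
  Fin.snoc v (n - ∑ i, v i)

def goodTuples (p : ℕ) (Z : Finset ℤ) (n : ℤ) : Finset (Fin (p + 1) → ℤ) :=
  (Fintype.piFinset fun _ : Fin (p + 1) => Z).filter fun v =>
    (n - ∑ i, v i) ∈ Z ∧
    ∃ i j : Fin (p + 1 + 1), i ≠ j ∧ fullTuple p n v i ≠ 0 ∧ fullTuple p n v j ≠ 0

/-- The nonlinear term `Σ_{q ∈ 𝓐_n ∩ 𝒵^{p+2}} H(p,q₁,q₂) k̂(q₁,t) ⋯ k̂(q_{p+2},t)`. -/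
noncomputable def gSum (p : ℕ) (Z : Finset ℤ) (kh : ℤ → ℝ → ℂ) (n : ℤ) (t : ℝ) : ℂ :=
  ∑ v ∈ goodTuples p Z n,
    Hcoef p (v 0) (v 1) * (∏ i, kh (v i) t) * kh (n - ∑ i, v i) t

/-- `k̂ : 𝒵 × [0,τ*) → ℂ` is a solution of the Galerkin system
`d/dt k̂(0,t) = (1/p) k̂(0,t)^{p+2} + Σ_{q ∈ 𝓐₀ ∩ 𝒵^{p+2}} H(p,q₁,q₂) k̂(q₁,t)⋯k̂(q_{p+2},t)`,
`d/dt k̂(n,t) = ((p+2)/p - n²) k̂(0,t)^{p+1} k̂(n,t) + Σ_{q ∈ 𝓐_n ∩ 𝒵^{p+2}} H(p,q₁,q₂) k̂(q₁,t)⋯k̂(q_{p+2},t)`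
for `n ∈ 𝒵`, `n ≠ 0`, with initial data `k̂(n,0) = ψ̂(n)` and the reality symmetry
`k̂(-n,t) = conj k̂(n,t)`.  Here `τ* ∈ (0,∞]` is modelled as an extended real number. -/
def IsGalerkin (p : ℕ) (Z : Finset ℤ) (tstar : EReal)
    (kh : ℤ → ℝ → ℂ) (ψh : ℤ → ℂ) : Prop :=
  (∀ t : ℝ, 0 ≤ t → (t : EReal) < tstar →
    HasDerivAt (kh 0) ((1 / (p : ℂ)) * (kh 0 t)^(p + 2) + gSum p Z kh 0 t) t) ∧
  (∀ n ∈ Z, n ≠ 0 → ∀ t : ℝ, 0 ≤ t → (t : EReal) < tstar →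
    HasDerivAt (kh n)
      ((((p : ℂ) + 2) / (p : ℂ) - (n : ℂ)^2) * (kh 0 t)^(p + 1) * kh n t
        + gSum p Z kh n t) t) ∧
  (∀ n ∈ Z, kh n 0 = ψh n) ∧
  (∀ n ∈ Z, ∀ t : ℝ, 0 ≤ t → (t : EReal) < tstar →
    kh (-n) t = (starRingEnd ℂ) (kh n t))

/-- The trigonometric polynomial `k(θ,t) = Σ_{n ∈ 𝒵} k̂(n,t) e^{inθ}`. -/
noncomputable def kpoly (Z : Finset ℤ) (kh : ℤ → ℝ → ℂ) (t θ : ℝ) : ℂ :=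
  ∑ n ∈ Z, kh n t * Complex.exp (Complex.I * (n : ℂ) * (θ : ℂ))

/-- The seminorm `‖ψ‖₂ = max{sup_{n ∈ 𝒵} n²|Re ψ̂(n)|, sup_{n ∈ 𝒵} n²|Im ψ̂(n)|}`. -/
noncomputable def snZ (Z : Finset ℤ) (ψh : ℤ → ℂ) : ℝ :=
  max (⨆ n : Z, ((n : ℤ) : ℝ)^2 * |(ψh n).re|)
      (⨆ n : Z, ((n : ℤ) : ℝ)^2 * |(ψh n).im|)

/-- The weight `1 / q²`, set to `1` at `q = 0`. -/
noncomputable def sqWeight (q : ℤ) : ℝ := 1 / (q : ℝ) ^ 2 + if q = 0 then 1 else 0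

lemma sqWeight_zero : sqWeight 0 = 1 := by simp [sqWeight]

lemma sqWeight_of_ne {q : ℤ} (hq : q ≠ 0) : sqWeight q = 1 / (q : ℝ) ^ 2 := by
  simp [sqWeight, hq]

lemma one_le_sq_of_ne_zero {q : ℤ} (hq : q ≠ 0) : (1 : ℝ) ≤ (q : ℝ) ^ 2 := by
  have h : (1 : ℤ) ≤ q ^ 2 := Int.add_one_le_iff.mpr (sq_pos_of_ne_zero hq)
  exact_mod_cast h

lemma sqWeight_nonneg (q : ℤ) : 0 ≤ sqWeight q := by
  unfold sqWeight
  positivity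

lemma sqWeight_le_one (q : ℤ) : sqWeight q ≤ 1 := by
  rcases eq_or_ne q 0 with rfl | hq
  · exact sqWeight_zero.le
  · rw [sqWeight_of_ne hq]
    exact (div_le_one (by positivity)).2 (one_le_sq_of_ne_zero hq)

lemma sq_mul_sqWeight_le_one (q : ℤ) : (q : ℝ) ^ 2 * sqWeight q ≤ 1 := by
  rcases eq_or_ne q 0 with rfl | hq
  · simp
  · have hq' : (q : ℝ) ≠ 0 := by exact_mod_cast hq
    rw [sqWeight_of_ne hq, mul_one_div_cancel (by positivity)]

lemma summable_sqWeight : Summable sqWeight :=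
  (Real.summable_one_div_int_pow.2 one_lt_two).add
    (summable_of_ne_finset_zero (s := {0}) fun q hq => by simp_all)

lemma one_le_tsum_sqWeight : 1 ≤ ∑' q, sqWeight q :=
  sqWeight_zero.symm.le.trans (summable_sqWeight.le_tsum 0 fun q _ => sqWeight_nonneg q)

lemma sum_prod_sqWeight_le {α : Type*} {m : ℕ} (Z : Finset ℤ) (s : Finset α)
    (φ : α → Fin m → ℤ) (hφ : Set.InjOn φ s) (hZ : ∀ v ∈ s, ∀ i, φ v i ∈ Z) :
    ∑ v ∈ s, ∏ i, sqWeight (φ v i) ≤ (∑' q, sqWeight q) ^ m := by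
  classical
  calc ∑ v ∈ s, ∏ i, sqWeight (φ v i)
      = ∑ w ∈ s.image φ, ∏ i, sqWeight (w i) :=
        (Finset.sum_image (f := fun w : Fin m → ℤ => ∏ i, sqWeight (w i)) hφ).symm
    _ ≤ ∑ w ∈ Fintype.piFinset fun _ : Fin m => Z, ∏ i, sqWeight (w i) := by
        refine Finset.sum_le_sum_of_subset_of_nonneg ?_
          fun w _ _ => Finset.prod_nonneg fun i _ => sqWeight_nonneg _
        intro w hw
        obtain ⟨v, hv, rfl⟩ := Finset.mem_image.1 hw
        exact Fintype.mem_piFinset.2 (hZ v hv)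
    _ = ∏ _i : Fin m, ∑ q ∈ Z, sqWeight q := (Finset.prod_univ_sum _ _).symm
    _ = (∑ q ∈ Z, sqWeight q) ^ m := by simp
    _ ≤ (∑' q, sqWeight q) ^ m :=
        pow_le_pow_left₀ (Finset.sum_nonneg fun q _ => sqWeight_nonneg q)
          (summable_sqWeight.sum_le_tsum Z fun q _ => sqWeight_nonneg q) m

/-- Exchange of the coordinate `v j` with the coordinate determined by the total `n`. -/
def swapLast {m : ℕ} (n : ℤ) (j : Fin m) (v : Fin m → ℤ) : Fin m → ℤ :=
  Function.update v j (n - ∑ i, v i)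

lemma swapLast_injective {m : ℕ} (n : ℤ) (j : Fin m) : Function.Injective (swapLast n j) := by
  have key : ∀ v : Fin m → ℤ, n - ∑ i, swapLast n j v i = v j := by
    intro v
    have h := Finset.add_sum_erase Finset.univ v (Finset.mem_univ j)
    simp only [swapLast, Finset.sum_update_of_mem (Finset.mem_univ j),
      Finset.sdiff_singleton_eq_erase]
    linarith
  intro v w h
  funext i
  by_cases hi : i = j
  · subst hi
    rw [← key v, ← key w, h]
  · simpa [swapLast, hi] using congrFun h i

lemma swapLast_mem {m : ℕ} {Z : Finset ℤ} {n : ℤ} {v : Fin m → ℤ} (hv : ∀ i, v i ∈ Z)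
    (hn : n - ∑ i, v i ∈ Z) (j i : Fin m) : swapLast n j v i ∈ Z := by
  by_cases hi : i = j
  · subst hi
    simpa [swapLast] using hn
  · simpa [swapLast, hi] using hv i

lemma sq_mul_prod_sqWeight_le {m : ℕ} (n : ℤ) (j : Fin m) (v : Fin m → ℤ) :
    (v j : ℝ) ^ 2 * ((∏ i, sqWeight (v i)) * sqWeight (n - ∑ i, v i)) ≤
      ∏ i, sqWeight (swapLast n j v i) := by
  have h1 : ∏ i, sqWeight (swapLast n j v i) =
      sqWeight (n - ∑ i, v i) * ∏ i ∈ Finset.univ.erase j, sqWeight (v i) := by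
    rw [← Finset.mul_prod_erase Finset.univ _ (Finset.mem_univ j)]
    congr 1
    · simp [swapLast]
    · refine Finset.prod_congr rfl fun i hi => ?_
      simp [swapLast, Finset.ne_of_mem_erase hi]
  rw [h1, ← Finset.mul_prod_erase Finset.univ (fun i => sqWeight (v i)) (Finset.mem_univ j)]
  have h2 : 0 ≤ sqWeight (n - ∑ i, v i) * ∏ i ∈ Finset.univ.erase j, sqWeight (v i) :=
    mul_nonneg (sqWeight_nonneg _) (Finset.prod_nonneg fun i _ => sqWeight_nonneg _)
  nlinarith [mul_le_mul_of_nonneg_right (sq_mul_sqWeight_le_one (v j)) h2]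

lemma norm_Hcoef_le {p : ℕ} (hp : 1 ≤ p) (a b : ℤ) :
    ‖Hcoef p a b‖ ≤ 1 + p * (a : ℝ) ^ 2 + p * (b : ℝ) ^ 2 := by
  have hp' : (1 : ℝ) ≤ p := by exact_mod_cast hp
  have h : Hcoef p a b = ((1 / (p : ℝ) - ((p : ℝ) - 1) * a * b - (a : ℝ) ^ 2 : ℝ) : ℂ) := by
    simp [Hcoef]
  rw [h, Complex.norm_real, Real.norm_eq_abs, abs_le]
  have h1 : 1 / (p : ℝ) ≤ 1 := (div_le_one (by positivity)).2 hp'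
  have h2 : 0 ≤ 1 / (p : ℝ) := by positivity
  have h3 : 0 ≤ (p : ℝ) - 1 := by linarith
  constructor
  · nlinarith [mul_nonneg h3 (sq_nonneg ((a : ℝ) - b)), mul_nonneg h3 (sq_nonneg (a : ℝ)),
      mul_nonneg h3 (sq_nonneg (b : ℝ)), sq_nonneg (a : ℝ), sq_nonneg (b : ℝ)]
  · nlinarith [mul_nonneg h3 (sq_nonneg ((a : ℝ) + b)), mul_nonneg h3 (sq_nonneg (a : ℝ)),
      mul_nonneg h3 (sq_nonneg (b : ℝ)), sq_nonneg (a : ℝ), sq_nonneg (b : ℝ)]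

lemma prod_norm_le_of_two_ne_zero {m : ℕ} (f : ℤ → ℂ) (q : Fin m → ℤ) {a ε : ℝ}
    (ha : 0 ≤ a) (hε : 0 ≤ ε) (hε1 : ε ≤ 1) (h0 : ‖f 0‖ ≤ a)
    (hf : ∀ i, q i ≠ 0 → (q i : ℝ) ^ 2 * ‖f (q i)‖ ≤ a * ε)
    (hq : ∃ i j, i ≠ j ∧ q i ≠ 0 ∧ q j ≠ 0) :
    ∏ i, ‖f (q i)‖ ≤ a ^ m * ε ^ 2 * ∏ i, sqWeight (q i) := by
  have hle : ∀ i, ‖f (q i)‖ ≤ a * (if q i ≠ 0 then ε else 1) * sqWeight (q i) := by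
    intro i
    by_cases hi : q i = 0
    · simpa [hi, sqWeight_zero] using h0
    · have hpos : 0 < (q i : ℝ) ^ 2 := zero_lt_one.trans_le (one_le_sq_of_ne_zero hi)
      rw [if_pos hi, sqWeight_of_ne hi, mul_one_div, le_div_iff₀ hpos, mul_comm]
      exact hf i hi
  have hcard : 2 ≤ (Finset.univ.filter fun i => q i ≠ 0).card := by
    obtain ⟨i, j, hij, hi, hj⟩ := hq
    exact Finset.one_lt_card.2 ⟨i, by simpa using hi, j, by simpa using hj, hij⟩
  have hprod : ∏ i, (if q i ≠ 0 then ε else 1) ≤ ε ^ 2 := by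
    rw [Finset.prod_ite, Finset.prod_const, Finset.prod_const_one, mul_one]
    exact pow_le_pow_of_le_one hε hε1 hcard
  calc ∏ i, ‖f (q i)‖
      ≤ ∏ i, (a * (if q i ≠ 0 then ε else 1) * sqWeight (q i)) :=
        Finset.prod_le_prod (fun i _ => norm_nonneg _) fun i _ => hle i
    _ = a ^ m * (∏ i, (if q i ≠ 0 then ε else 1)) * ∏ i, sqWeight (q i) := by
        rw [Finset.prod_mul_distrib, Finset.prod_mul_distrib]
        simp
    _ ≤ a ^ m * ε ^ 2 * ∏ i, sqWeight (q i) := by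
        refine mul_le_mul_of_nonneg_right (mul_le_mul_of_nonneg_left hprod (by positivity)) ?_
        exact Finset.prod_nonneg fun i _ => sqWeight_nonneg _

lemma norm_gSum_le {p : ℕ} (hp : 1 ≤ p) (Z : Finset ℤ) (kh : ℤ → ℝ → ℂ) (n : ℤ) (t : ℝ)
    {a ε : ℝ} (ha : 0 ≤ a) (hε : 0 ≤ ε) (hε1 : ε ≤ 1) (h0 : ‖kh 0 t‖ ≤ a)
    (hkh : ∀ q ∈ Z, q ≠ 0 → (q : ℝ) ^ 2 * ‖kh q t‖ ≤ a * ε) :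
    ‖gSum p Z kh n t‖ ≤
      a ^ (p + 2) * ε ^ 2 * ((1 + 2 * p) * (∑' q, sqWeight q) ^ (p + 1)) := by
  have hmem : ∀ v ∈ goodTuples p Z n, (∀ i, v i ∈ Z) ∧ n - ∑ i, v i ∈ Z ∧
      ∃ i j, i ≠ j ∧ fullTuple p n v i ≠ 0 ∧ fullTuple p n v j ≠ 0 := by
    intro v hv
    obtain ⟨h1, h2⟩ := Finset.mem_filter.1 hv
    exact ⟨Fintype.mem_piFinset.1 h1, h2⟩
  have hterm : ∀ v ∈ goodTuples p Z n,
      ‖Hcoef p (v 0) (v 1) * (∏ i, kh (v i) t) * kh (n - ∑ i, v i) t‖ ≤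
      a ^ (p + 2) * ε ^ 2 * (∏ i, sqWeight (v i) + p * ∏ i, sqWeight (swapLast n 0 v i)
        + p * ∏ i, sqWeight (swapLast n 1 v i)) := by
    intro v hv
    obtain ⟨hvZ, hnZ, hne⟩ := hmem v hv
    have hfZ : ∀ i, fullTuple p n v i ∈ Z := by
      intro i
      induction i using Fin.lastCases with
      | last => simpa [fullTuple] using hnZ
      | cast i => simpa [fullTuple] using hvZ i
    have hP := prod_norm_le_of_two_ne_zero (fun q => kh q t) (fullTuple p n v) ha hε hε1 h0
      (fun i hi => hkh _ (hfZ i) hi) hne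
    rw [Fin.prod_univ_castSucc fun i => ‖kh (fullTuple p n v i) t‖,
      Fin.prod_univ_castSucc fun i => sqWeight (fullTuple p n v i)] at hP
    simp only [fullTuple, Fin.snoc_castSucc, Fin.snoc_last] at hP
    set P := (∏ i, sqWeight (v i)) * sqWeight (n - ∑ i, v i) with hPdef
    have hv0 : 0 ≤ ∏ i, sqWeight (v i) := Finset.prod_nonneg fun i _ => sqWeight_nonneg _
    have hP0 : 0 ≤ P := mul_nonneg hv0 (sqWeight_nonneg _)
    have hP1 : P ≤ ∏ i, sqWeight (v i) := mul_le_of_le_one_right hv0 (sqWeight_le_one _)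
    have hs0 := sq_mul_prod_sqWeight_le n 0 v
    have hs1 := sq_mul_prod_sqWeight_le n 1 v
    have hp0 : (0 : ℝ) ≤ p := Nat.cast_nonneg p
    rw [mul_assoc, norm_mul, norm_mul, norm_prod]
    calc ‖Hcoef p (v 0) (v 1)‖ * ((∏ i, ‖kh (v i) t‖) * ‖kh (n - ∑ i, v i) t‖)
        ≤ (1 + p * (v 0 : ℝ) ^ 2 + p * (v 1 : ℝ) ^ 2) * (a ^ (p + 2) * ε ^ 2 * P) :=
          mul_le_mul (norm_Hcoef_le hp _ _) hP (by positivity) (by positivity)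
      _ = a ^ (p + 2) * ε ^ 2 * (P + p * ((v 0 : ℝ) ^ 2 * P) + p * ((v 1 : ℝ) ^ 2 * P)) := by
          ring
      _ ≤ _ := by gcongr
  have hA : ∑ v ∈ goodTuples p Z n, ∏ i, sqWeight (v i) ≤ (∑' q, sqWeight q) ^ (p + 1) :=
    sum_prod_sqWeight_le Z _ (fun v => v) (fun _ _ _ _ h => h) fun v hv => (hmem v hv).1
  have hS : ∀ j, ∑ v ∈ goodTuples p Z n, ∏ i, sqWeight (swapLast n j v i) ≤
      (∑' q, sqWeight q) ^ (p + 1) := fun j =>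
    sum_prod_sqWeight_le Z _ (swapLast n j) (swapLast_injective n j).injOn
      fun v hv => swapLast_mem (hmem v hv).1 (hmem v hv).2.1 j
  calc ‖gSum p Z kh n t‖
      ≤ ∑ v ∈ goodTuples p Z n, a ^ (p + 2) * ε ^ 2 *
        (∏ i, sqWeight (v i) + p * ∏ i, sqWeight (swapLast n 0 v i)
          + p * ∏ i, sqWeight (swapLast n 1 v i)) := norm_sum_le_of_le _ hterm
    _ = a ^ (p + 2) * ε ^ 2 * (∑ v ∈ goodTuples p Z n, ∏ i, sqWeight (v i)
          + p * ∑ v ∈ goodTuples p Z n, ∏ i, sqWeight (swapLast n 0 v i)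
          + p * ∑ v ∈ goodTuples p Z n, ∏ i, sqWeight (swapLast n 1 v i)) := by
        simp only [← Finset.mul_sum, Finset.sum_add_distrib]
    _ ≤ a ^ (p + 2) * ε ^ 2 * ((∑' q, sqWeight q) ^ (p + 1)
          + p * (∑' q, sqWeight q) ^ (p + 1) + p * (∑' q, sqWeight q) ^ (p + 1)) := by
        gcongr
        · exact hS 0
        · exact hS 1
    _ = _ := by ring

/-- A curve driven by a strong enough linear damping cannot cross the sphere of radius `R`. -/
lemma norm_le_of_damped {k : ℝ → ℂ} {c : ℝ → ℝ} {g : ℝ → ℂ} {R T : ℝ} (hR : 0 < R) (hT : 0 ≤ T)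
    (hk : ∀ s ∈ Set.Icc 0 T, HasDerivAt k ((c s : ℂ) * k s + g s) s)
    (hinit : ‖k 0‖ ≤ R) (hlt : ∀ s ∈ Set.Ico 0 T, c s * R + ‖g s‖ < 0) : ‖k T‖ ≤ R := by
  have hd : ∀ s ∈ Set.Icc 0 T, HasDerivAt (fun s => ‖k s‖ ^ 2)
      (2 * inner ℝ (k s) ((c s : ℂ) * k s + g s)) s := fun s hs => (hk s hs).norm_sq
  have h := image_le_of_deriv_right_lt_deriv_boundary (f := fun s => ‖k s‖ ^ 2)
    (B := fun _ => R ^ 2) (B' := fun _ => 0) (a := 0) (b := T)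
    (fun s hs => (hd s hs).continuousAt.continuousWithinAt)
    (fun s hs => (hd s (Set.Ico_subset_Icc_self hs)).hasDerivWithinAt)
    (by simpa using pow_le_pow_left₀ (norm_nonneg _) hinit 2)
    (fun s => hasDerivAt_const s _) ?_ (Set.right_mem_Icc.2 hT)
  · exact (sq_le_sq₀ (norm_nonneg _) hR.le).1 h
  · intro s hs hsR
    have hsR' : ‖k s‖ = R := (sq_eq_sq₀ (norm_nonneg _) hR.le).1 hsR
    have h1 : inner ℝ (k s) ((c s : ℂ) * k s) = c s * R ^ 2 := by
      rw [← Complex.real_smul, real_inner_smul_right, real_inner_self_eq_norm_sq, hsR']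
    have h2 : inner ℝ (k s) (g s) ≤ R * ‖g s‖ := hsR' ▸ real_inner_le_norm (k s) (g s)
    rw [inner_add_right, h1]
    nlinarith [mul_neg_of_pos_of_neg hR (hlt s hs)]

/-- There is `δ ∈ (0,1/4)` depending only on `p` such that: if the initial data
satisfy `2δ ψ̂(0) ≥ |ψ̂(±1)|` and `δ ψ̂(0) ≥ q² |ψ̂(q)|` for `|q| ≥ 2`, and on `(0,t₁)` one has
`2δ ψ̂(0) ≥ |k̂(±1,t)|`, `2δ ψ̂(0) ≥ q² |k̂(q,t)|` for `|q| ≥ 2`, and `k̂(0,t) ≥ (1-δ) ψ̂(0)`,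
then in fact `δ ψ̂(0) ≥ q² |k̂(q,t)|` for all `q ∈ 𝒵` with `|q| ≥ 2` and all `t ∈ (0,t₁)`. -/
theorem statement3 (p : ℕ) (hp : 1 ≤ p) :
    ∃ δ : ℝ, δ ∈ Set.Ioo (0:ℝ) (1/4) ∧
      ∀ (Z : Finset ℤ), (0:ℤ) ∈ Z → (∀ n ∈ Z, -n ∈ Z) →
      ∀ (tstar : EReal), 0 < tstar →
      ∀ (kh : ℤ → ℝ → ℂ) (ψh : ℤ → ℂ), IsGalerkin p Z tstar kh ψh →
      0 < (ψh 0).re →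
      (∀ q ∈ Z, (q = 1 ∨ q = -1) → ‖ψh q‖ ≤ 2 * δ * (ψh 0).re) →
      (∀ q ∈ Z, 2 ≤ |q| → (q : ℝ)^2 * ‖ψh q‖ ≤ δ * (ψh 0).re) →
      ∀ t₁ : ℝ, 0 < t₁ → (t₁ : EReal) < tstar →
      (∀ t : ℝ, 0 < t → t < t₁ →
        (∀ q ∈ Z, (q = 1 ∨ q = -1) → ‖kh q t‖ ≤ 2 * δ * (ψh 0).re) ∧
        (∀ q ∈ Z, 2 ≤ |q| → (q : ℝ)^2 * ‖kh q t‖ ≤ 2 * δ * (ψh 0).re) ∧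
        (1 - δ) * (ψh 0).re ≤ (kh 0 t).re) →
      ∀ t : ℝ, 0 < t → t < t₁ →
        ∀ q ∈ Z, 2 ≤ |q| → (q : ℝ)^2 * ‖kh q t‖ ≤ δ * (ψh 0).re := by
  set M : ℝ := (1 + 2 * p) * (∑' q, sqWeight q) ^ (p + 1) with hM
  have hM1 : 1 ≤ M := one_le_mul_of_one_le_of_one_le
    (by linarith [(Nat.cast_nonneg p : (0 : ℝ) ≤ p)]) (one_le_pow₀ one_le_tsum_sqWeight)
  have hM0 : 0 < M := by linarith
  obtain ⟨δ, hδ⟩ : ∃ δ : ℝ, δ = 1 / (32 * M) := ⟨_, rfl⟩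
  have hδM : δ * M = 1 / 32 := by
    rw [hδ]
    field_simp
  have hδ0 : 0 < δ := by
    rw [hδ]
    positivity
  have hδ1 : δ ≤ 1 / 32 := by nlinarith
  refine ⟨δ, ⟨hδ0, by linarith⟩, ?_⟩
  intro Z hZ0 _ tstar _ kh ψh ⟨_, hode, hini, hsymm⟩ hK hψ1 hψ2 t₁ _ ht₁ hboot t ht htt q hq hq2
  set K := (ψh 0).re with hKdef
  have hboot' : ∀ s : ℝ, 0 ≤ s → s < t₁ →
      (∀ n ∈ Z, n ≠ 0 → (n : ℝ) ^ 2 * ‖kh n s‖ ≤ 2 * δ * K) ∧ (1 - δ) * K ≤ (kh 0 s).re := by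
    intro s hs hst
    rcases hs.eq_or_lt with rfl | hs
    · refine ⟨fun n hn hn0 => ?_, ?_⟩
      · rw [hini n hn]
        by_cases h1 : n = 1 ∨ n = -1
        · have := hψ1 n hn h1
          rcases h1 with rfl | rfl <;> simpa using this
        · have := hψ2 n hn (le_abs.2 (by omega))
          nlinarith
      · rw [hini 0 hZ0]
        nlinarith
    · obtain ⟨h1, h2, h3⟩ := hboot s hs hst
      refine ⟨fun n hn hn0 => ?_, h3⟩
      by_cases h : n = 1 ∨ n = -1
      · have := h1 n hn h
        rcases h with rfl | rfl <;> simpa using this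
      · exact h2 n hn (le_abs.2 (by omega))
  have hq0 : q ≠ 0 := by
    rintro rfl
    simp at hq2
  have hq4 : (4 : ℝ) ≤ (q : ℝ) ^ 2 := by
    have : (2 : ℝ) ≤ |(q : ℝ)| := by exact_mod_cast hq2
    rw [← sq_abs]
    nlinarith
  have htime : ∀ s, s < t₁ → (s : EReal) < tstar := fun s hs =>
    (EReal.coe_lt_coe_iff.2 hs).trans ht₁
  have hreal : ∀ s, 0 ≤ s → s < t₁ → kh 0 s = ((kh 0 s).re : ℂ) := by
    intro s hs hst
    have := hsymm 0 hZ0 s hs (htime s hst)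
    rw [neg_zero] at this
    exact (Complex.conj_eq_iff_re.1 this.symm).symm
  have hmain : ‖kh q t‖ ≤ δ * K / (q : ℝ) ^ 2 := by
    refine norm_le_of_damped (k := kh q)
      (c := fun s => (((p : ℝ) + 2) / p - (q : ℝ) ^ 2) * (kh 0 s).re ^ (p + 1))
      (g := gSum p Z kh q) (by positivity) ht.le ?_ ?_ ?_
    · intro s hs
      have hst := hs.2.trans_lt htt
      convert hode q hq hq0 s hs.1 (htime s hst) using 3
      rw [hreal s hs.1 hst]
      push_cast
      simp
    · rw [hini q hq, le_div_iff₀ (by positivity), mul_comm]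
      exact hψ2 q hq hq2
    · intro s hs
      have hst := hs.2.trans htt
      obtain ⟨hb, ha⟩ := hboot' s hs.1 hst
      have hr := hreal s hs.1 hst
      set a := (kh 0 s).re with hadef
      have haK : K / 2 < a := by nlinarith
      have ha0 : 0 < a := by linarith
      have hg := norm_gSum_le hp Z kh q s ha0.le (ε := 2 * δ * K / a) (by positivity)
        ((div_le_one ha0).2 (by nlinarith))
        (by rw [hr, Complex.norm_real, Real.norm_of_nonneg ha0.le])
        (fun n hn hn0 => by
          rw [mul_div_cancel₀ _ ha0.ne']
          exact hb n hn hn0)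
      rw [← hM] at hg
      have hpow : 0 < a ^ p := by positivity
      have hg' : a ^ (p + 2) * (2 * δ * K / a) ^ 2 * M = a ^ p * (δ * K * K / 8) := by
        have : a ^ (p + 2) * (2 * δ * K / a) ^ 2 * M = a ^ p * (4 * δ * K * K * (δ * M)) := by
          field_simp
          ring
        rw [this, hδM]
        ring
      have hlin : (((p : ℝ) + 2) / p - (q : ℝ) ^ 2) * (δ * K / (q : ℝ) ^ 2) ≤ -(δ * K / 4) := by
        have hp' : (1 : ℝ) ≤ p := by exact_mod_cast hp
        have h3 : ((p : ℝ) + 2) / p ≤ 3 := (div_le_iff₀ (by positivity)).2 (by linarith)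
        rw [mul_div_assoc', div_le_iff₀ (by positivity)]
        have hδK : 0 < δ * K := by positivity
        nlinarith
      have hfin : δ * K * K / 8 < a * (δ * K / 4) := by
        have hδK : 0 < δ * K := by positivity
        nlinarith
      calc (((p : ℝ) + 2) / p - (q : ℝ) ^ 2) * a ^ (p + 1) * (δ * K / (q : ℝ) ^ 2)
            + ‖gSum p Z kh q s‖
          = a ^ p * (a * ((((p : ℝ) + 2) / p - (q : ℝ) ^ 2) * (δ * K / (q : ℝ) ^ 2)))
            + ‖gSum p Z kh q s‖ := by ring
        _ ≤ a ^ p * (a * -(δ * K / 4)) + a ^ p * (δ * K * K / 8) := by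
            rw [← hg']
            gcongr
        _ = -(a ^ p * (a * (δ * K / 4) - δ * K * K / 8)) := by ring
        _ < 0 := neg_lt_zero.2 (mul_pos hpow (by linarith))
  rw [le_div_iff₀ (by positivity)] at hmain
  linarith
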